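/- Let X be a real Banach space and let J : X → ℝ be continuously Fréchet differentiable. Assume that J satisfies the Palais–Smale condition, that J is even (J(−u) = J(u) for all u ∈ X), bounded from below, and J(0) = 0. Assume furthermore that for every integer k ≥ 1 there exist ρ_k > 0 and a k-dimensional linear subspace X_k of X such that sup { J(u) : u ∈ X_k, ‖u‖_X = ρ_k } < 0. Then there exists a sequence (u_k) in X of critical points of J (i.e. J'(u_k) = 0) with J(u_k) < 0 for all k and lim_{k→∞} J(u_k) = 0. -/

import Mathlib

open Filter

/-! ### A combinatorial Borsuk–Ulam theorem

Labels are natural numbers; `x` and `oppositeLabel x` share the level `x / 2` and have opposite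
parities. -/

/-- The label with the same level and the opposite sign. -/
def oppositeLabel (x : ℕ) : ℕ := 4 * (x / 2) + 1 - x

theorem cast_oppositeLabel (x : ℕ) : (oppositeLabel x : ZMod 2) = x + 1 := by
  have h : (oppositeLabel x + x : ℕ) = 4 * (x / 2) + 1 := by unfold oppositeLabel; omega
  have h2 : ((oppositeLabel x + x : ℕ) : ZMod 2) = 1 := by
    rw [h]; push_cast
    have : (4 : ZMod 2) = 0 := rfl
    simp [this]
  push_cast at h2
  rw [← CharTwo.sub_eq_add] at h2
  rw [sub_eq_iff_eq_add.1 h2, add_comm]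

/-- Detects the lists of labels whose signs alternate, the first one differing from `c`. -/
def alternatingWeight : ZMod 2 → List ℕ → ZMod 2
  | _, [] => 1
  | c, a :: l => (c + a) * alternatingWeight a l

theorem alternatingWeight_map_oppositeLabel (c : ZMod 2) (l : List ℕ) :
    alternatingWeight c (l.map oppositeLabel) = alternatingWeight (c + 1) l := by
  induction l generalizing c with
  | nil => rfl
  | cons a t ih =>
    simp only [List.map_cons, alternatingWeight, ih, cast_oppositeLabel]
    rw [add_assoc (a : ZMod 2), CharTwo.add_self_eq_zero, add_zero]
    ring

theorem sum_alternatingWeight_erase (c : ZMod 2) (l : List ℕ) (hl : l.Pairwise (· ≤ ·)) :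
    (l.map fun x => alternatingWeight c (l.erase x)).sum =
      alternatingWeight c l + alternatingWeight (c + 1) l := by
  induction l generalizing c with
  | nil => simp [alternatingWeight, CharTwo.add_self_eq_zero]
  | cons a t ih =>
    rw [List.pairwise_cons] at hl
    have herase : ∀ x ∈ t, (a :: t).erase x = a :: t.erase x := by
      intro x hx
      by_cases hax : a = x
      · subst hax
        rw [List.erase_cons_head]
        refine (List.perm_cons_erase hx).eq_of_pairwise' (r := (· ≤ ·)) hl.2 ?_
        exact List.pairwise_cons.2
          ⟨fun y hy => hl.1 y (List.mem_of_mem_erase hy), hl.2.sublist List.erase_sublist⟩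
      · rw [List.erase_cons_tail (by simpa using hax)]
    rw [List.map_cons, List.sum_cons, List.erase_cons_head]
    rw [List.map_congr_left (g := fun x => (c + a) * alternatingWeight a (t.erase x))
      (fun x hx => by rw [herase x hx, alternatingWeight])]
    rw [List.sum_map_mul_left, ih _ hl.2]
    simp only [alternatingWeight]
    have hc : c = a ∨ c = a + 1 := by
      generalize (a : ZMod 2) = b
      revert c b; decide
    rcases hc with rfl | rfl
    all_goals
      generalize alternatingWeight (a : ZMod 2) t = p
      generalize alternatingWeight (a + 1 : ZMod 2) t = q
      generalize (a : ZMod 2) = b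
      revert p q b; decide

/-- A multiset of labels is consistent if it contains no pair of opposite labels. -/
def ConsistentLabels (M : Multiset ℕ) : Prop := ∀ x ∈ M, oppositeLabel x ∉ M

theorem length_add_le_of_alternatingWeight_ne_zero {m : ℕ} (l : List ℕ) (j c : ℕ)
    (hl : l.Pairwise (· ≤ ·)) (hcons : ∀ x ∈ l, oppositeLabel x ∉ l)
    (hlow : ∀ x ∈ l, 2 * j ≤ x) (hup : ∀ x ∈ l, x < 2 * m + 2) (hj : j ≤ m)
    (hsign : ∀ x ∈ l, x / 2 = j → (x : ZMod 2) = c) (h0 : alternatingWeight c l ≠ 0) :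
    l.length + j ≤ m := by
  induction l generalizing j c with
  | nil => simpa using hj
  | cons a t ih =>
    rw [List.pairwise_cons] at hl
    simp only [alternatingWeight] at h0
    have h1 := left_ne_zero_of_mul h0
    have h2 := right_ne_zero_of_mul h0
    have haj : a / 2 ≠ j := by
      intro h
      apply h1
      rw [hsign a (by simp) h, CharTwo.add_self_eq_zero]
    have ha1 := hlow a (by simp)
    have ha2 := hup a (by simp)
    have := ih (a / 2) a hl.2
      (fun x hx hx' => hcons x (List.mem_cons_of_mem _ hx) (List.mem_cons_of_mem _ hx'))
      (fun x hx => by have := hl.1 x hx; omega)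
      (fun x hx => hup x (List.mem_cons_of_mem _ hx)) (by omega)
      (fun x hx hxa => by
        have hne : oppositeLabel a ≠ x := by
          rintro rfl
          exact hcons a (by simp) (List.mem_cons_of_mem _ hx)
        have : x = a := by unfold oppositeLabel at hne; omega
        rw [this]) h2
    simp only [List.length_cons]
    omega

/-- Detects the multisets of labels with pairwise distinct levels whose signs alternate when they
are sorted by level, the first one being odd. -/
def labelWeight (M : Multiset ℕ) : ZMod 2 := alternatingWeight 0 M.sort

theorem labelWeight_zero : labelWeight 0 = 1 := by
  simp [labelWeight, alternatingWeight]

theorem labelWeight_eq_zero_of_card {m : ℕ} {M : Multiset ℕ} (hM : ConsistentLabels M)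
    (hlow : ∀ x ∈ M, 2 ≤ x) (hup : ∀ x ∈ M, x < 2 * m + 2) (hcard : m < M.card) :
    labelWeight M = 0 := by
  by_contra h
  have := length_add_le_of_alternatingWeight_ne_zero (m := m) M.sort 0 0 (M.pairwise_sort (· ≤ ·))
    (fun x hx => by simp only [Multiset.mem_sort] at hx ⊢; exact hM x hx)
    (by simp) (fun x hx => hup x (by simpa using hx)) (Nat.zero_le _)
    (fun x hx hx0 => by have := hlow x (by simpa using hx); omega)
    (by simpa [labelWeight] using h)
  rw [Multiset.length_sort] at this
  omega

theorem sum_labelWeight_erase {M : Multiset ℕ} (hM : ConsistentLabels M) :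
    (M.map fun x => labelWeight (M.erase x)).sum =
      labelWeight M + labelWeight (M.map oppositeLabel) := by
  have hsort : ∀ l : List ℕ, l.Pairwise (· ≤ ·) → (l : Multiset ℕ).sort = l := fun l hl => by
    refine List.Perm.eq_of_pairwise' (r := (· ≤ ·)) (Multiset.pairwise_sort _ _) hl ?_
    rw [← Multiset.coe_eq_coe, Multiset.sort_eq]
  have hs := M.pairwise_sort (· ≤ ·)
  have h1 : labelWeight (M.map oppositeLabel) = alternatingWeight 1 M.sort := by
    rw [labelWeight, ← Multiset.map_sort (r := (· ≤ ·)) (r' := (· ≤ ·)),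
      alternatingWeight_map_oppositeLabel, zero_add]
    intro a ha b hb
    have h1 := hM a ha
    have h2 : oppositeLabel a ≠ b := fun h => h1 (h ▸ hb)
    unfold oppositeLabel at *
    omega
  rw [h1, labelWeight, ← zero_add (1 : ZMod 2), ← sum_alternatingWeight_erase 0 _ hs]
  conv_lhs => rw [← M.sort_eq (· ≤ ·)]
  rw [Multiset.map_coe, Multiset.sum_coe]
  congr 1
  refine List.map_congr_left fun x _ => ?_
  rw [labelWeight, Multiset.coe_erase, hsort _ (hs.sublist List.erase_sublist)]

theorem oppositeLabel_oppositeLabel (x : ℕ) : oppositeLabel (oppositeLabel x) = x := by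
  unfold oppositeLabel; omega

/-- The antipodal involution of the vertices of the cross-polytope. -/
def flipSign : ℕ × Bool ≃ ℕ × Bool := Equiv.prodCongr (Equiv.refl ℕ) Equiv.boolNot

/-- The antipodal involution of the faces of the cross-polytope. -/
def antipode (Y : Finset (ℕ × Bool)) : Finset (ℕ × Bool) := Y.map flipSign.toEmbedding

theorem mem_antipode {Y : Finset (ℕ × Bool)} {i : ℕ} {s : Bool} :
    (i, s) ∈ antipode Y ↔ (i, !s) ∈ Y := by
  simp [antipode, flipSign, Finset.mem_map_equiv, Equiv.boolNot]

theorem antipode_erase (Y : Finset (ℕ × Bool)) (v : ℕ × Bool) :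
    antipode (Y.erase v) = (antipode Y).erase (flipSign v) :=
  Finset.map_erase _ _ _

theorem antipode_insert (Y : Finset (ℕ × Bool)) (i : ℕ) (s : Bool) :
    antipode (insert (i, s) Y) = insert (i, !s) (antipode Y) :=
  Finset.map_insert _ _ _

theorem card_antipode (Y : Finset (ℕ × Bool)) : (antipode Y).card = Y.card := Finset.card_map _

/-- The faces, possibly empty, of the `n`-dimensional cross-polytope. -/
def IsFace (n : ℕ) (Y : Finset (ℕ × Bool)) : Prop :=
  (∀ v ∈ Y, v.1 < n) ∧ ∀ i, (i, true) ∈ Y → (i, false) ∉ Y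

theorem IsFace.mono {n : ℕ} {X Y : Finset (ℕ × Bool)} (hY : IsFace n Y) (h : X ⊆ Y) :
    IsFace n X :=
  ⟨fun v hv => hY.1 v (h hv), fun i h1 h2 => hY.2 i (h h1) (h h2)⟩

theorem IsFace.insert {n : ℕ} {Y : Finset (ℕ × Bool)} (hY : IsFace n Y) (s : Bool) :
    IsFace (n + 1) (insert (n, s) Y) := by
  have hn : ∀ t, (n, t) ∉ Y := fun t ht => lt_irrefl _ (hY.1 _ ht)
  refine ⟨fun v hv => ?_, fun i h1 h2 => ?_⟩
  · rcases Finset.mem_insert.1 hv with rfl | hv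
    · exact Nat.lt_succ_self n
    · exact (hY.1 v hv).trans (Nat.lt_succ_self n)
  · rcases Finset.mem_insert.1 h1 with h1 | h1 <;> rcases Finset.mem_insert.1 h2 with h2 | h2
    · simp_all
    · simp only [Prod.mk.injEq] at h1; exact hn false (h1.1 ▸ h2)
    · simp only [Prod.mk.injEq] at h2; exact hn true (h2.1 ▸ h1)
    · exact hY.2 i h1 h2

theorem sum_erase_erase {V : Type*} [DecidableEq V] (g : Finset V → ZMod 2) (Y : Finset V) :
    ∑ v ∈ Y, ∑ w ∈ Y.erase v, g ((Y.erase v).erase w) = 0 := by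
  rw [Finset.sum_sigma']
  refine Finset.sum_involution (fun p _ => ⟨p.2, p.1⟩) ?_ ?_ ?_ ?_
  · rintro ⟨v, w⟩ _
    simp only [Finset.erase_right_comm (a := w)]
    exact CharTwo.add_self_eq_zero _
  · rintro ⟨v, w⟩ h _ heq
    simp only [Finset.mem_sigma, Finset.mem_erase] at h
    simp only [Sigma.mk.injEq] at heq
    exact h.2.1 heq.1
  · rintro ⟨v, w⟩ h
    simp only [Finset.mem_sigma, Finset.mem_erase] at h ⊢
    exact ⟨h.2.2, Ne.symm h.2.1, h.1⟩
  · rintro ⟨v, w⟩ _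
    rfl

section flagSum

variable {V : Type*} [DecidableEq V]

/-- The sum of `P` over the label multisets, enlarged by `M`, of the maximal flags of nonempty
subsets of a set `Y` of cardinality `k`. -/
def flagSum (lam : Finset V → ℕ) (P : Multiset ℕ → ZMod 2) :
    ℕ → Finset V → Multiset ℕ → ZMod 2
  | 0, _, M => P M
  | k + 1, Y, M => ∑ v ∈ Y, flagSum lam P k (Y.erase v) (lam Y ::ₘ M)

theorem flagSum_boundary (lam : Finset V → ℕ) (P : Multiset ℕ → ZMod 2) (k : ℕ) (Y : Finset V)
    (hk : Y.card = k) (M : Multiset ℕ) :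
    flagSum lam (fun N => (N.map fun x => P (N.erase x)).sum) k Y M =
      ∑ v ∈ Y, flagSum lam P (k - 1) (Y.erase v) M +
        (M.map fun x => flagSum lam P k Y (M.erase x)).sum := by
  induction k generalizing Y M with
  | zero => simp [Finset.card_eq_zero.1 hk, flagSum]
  | succ j ih =>
    have hcard : ∀ v ∈ Y, (Y.erase v).card = j := fun v hv => by
      rw [Finset.card_erase_of_mem hv, hk]; rfl
    simp only [flagSum]
    rw [Finset.sum_congr rfl fun v hv => ih (Y.erase v) (hcard v hv) (lam Y ::ₘ M),
      Finset.sum_add_distrib,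
      sum_erase_erase (fun Z => flagSum lam P (j - 1) Z (lam Y ::ₘ M)) Y, zero_add]
    simp only [Multiset.map_cons, Multiset.sum_cons, Multiset.erase_cons_head,
      Finset.sum_add_distrib, Nat.add_sub_cancel]
    congr 1
    rw [Multiset.sum_map_sum]
    refine Finset.sum_congr rfl fun v _ => congrArg Multiset.sum (Multiset.map_congr rfl ?_)
    intro x hx
    by_cases h : lam Y = x
    · rw [← h, Multiset.erase_cons_head, Multiset.cons_erase (h ▸ hx)]
    · rw [Multiset.erase_cons_tail _ h]

theorem flagSum_congr {lam : Finset V → ℕ} {P Q : Multiset ℕ → ZMod 2}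
    (Inv : Finset V → Multiset ℕ → Prop)
    (hstep : ∀ Y M, Inv Y M → ∀ v ∈ Y, Inv (Y.erase v) (lam Y ::ₘ M))
    (hPQ : ∀ M, Inv ∅ M → P M = Q M) (k : ℕ) (Y : Finset V) (hk : Y.card = k) (M : Multiset ℕ)
    (hY : Inv Y M) : flagSum lam P k Y M = flagSum lam Q k Y M := by
  induction k generalizing Y M with
  | zero => exact hPQ M (Finset.card_eq_zero.1 hk ▸ hY)
  | succ j ih =>
    refine Finset.sum_congr rfl fun v hv => ih _ ?_ _ (hstep Y M hY v hv)
    rw [Finset.card_erase_of_mem hv, hk]; rfl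

theorem flagSum_add (lam : Finset V → ℕ) (P Q : Multiset ℕ → ZMod 2) (k : ℕ) (Y : Finset V)
    (M : Multiset ℕ) :
    flagSum lam (fun N => P N + Q N) k Y M = flagSum lam P k Y M + flagSum lam Q k Y M := by
  induction k generalizing Y M with
  | zero => rfl
  | succ j ih => simp only [flagSum, ih, Finset.sum_add_distrib]

theorem flagSum_zero (lam : Finset V → ℕ) (k : ℕ) (Y : Finset V) (M : Multiset ℕ) :
    flagSum lam (fun _ => 0) k Y M = 0 := by
  induction k generalizing Y M with
  | zero => rfl
  | succ j ih => simp only [flagSum, ih, Finset.sum_const_zero]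

end flagSum

theorem flagSum_antipode {n : ℕ} {lam : Finset (ℕ × Bool) → ℕ}
    (hodd : ∀ Y, IsFace n Y → Y.Nonempty → lam (antipode Y) = oppositeLabel (lam Y))
    (P : Multiset ℕ → ZMod 2) (k : ℕ) (Y : Finset (ℕ × Bool)) (hY : IsFace n Y)
    (M : Multiset ℕ) :
    flagSum lam P k (antipode Y) (M.map oppositeLabel) =
      flagSum lam (fun N => P (N.map oppositeLabel)) k Y M := by
  induction k generalizing Y M with
  | zero => rfl
  | succ j ih =>
    simp only [flagSum]
    conv_lhs => rw [antipode, Finset.sum_map]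
    refine Finset.sum_congr rfl fun v hv => ?_
    rw [← ih _ (hY.mono (Finset.erase_subset _ _)), Multiset.map_cons, antipode_erase,
      ← hodd Y hY ⟨v, hv⟩]
    rfl

/-- The sum of `g` over the facets of the `k`-dimensional cross-polytope. -/
def facetSum : ℕ → (Finset (ℕ × Bool) → ZMod 2) → ZMod 2
  | 0, g => g ∅
  | k + 1, g => facetSum k (fun Y => g (insert (k, true) Y)) +
      facetSum k (fun Y => g (insert (k, false) Y))

theorem facetSum_congr {k : ℕ} {g h : Finset (ℕ × Bool) → ZMod 2}
    (H : ∀ Y, IsFace k Y → Y.card = k → g Y = h Y) : facetSum k g = facetSum k h := by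
  induction k generalizing g h with
  | zero => exact H ∅ ⟨by simp, by simp⟩ rfl
  | succ j ih =>
    have hcard : ∀ Y s, IsFace j Y → Y.card = j → (insert (j, s) Y).card = j + 1 :=
      fun Y s hY hc => by
        rw [Finset.card_insert_of_notMem fun ht => lt_irrefl _ (hY.1 _ ht), hc]
    simp only [facetSum]
    rw [ih fun Y hY hc => H _ (hY.insert true) (hcard Y _ hY hc),
      ih fun Y hY hc => H _ (hY.insert false) (hcard Y _ hY hc)]

theorem facetSum_add (k : ℕ) (g h : Finset (ℕ × Bool) → ZMod 2) :
    facetSum k (fun Y => g Y + h Y) = facetSum k g + facetSum k h := by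
  induction k generalizing g h with
  | zero => rfl
  | succ j ih => simp only [facetSum, ih]; ring

theorem facetSum_antipode (k : ℕ) (g : Finset (ℕ × Bool) → ZMod 2) :
    facetSum k (fun Y => g (antipode Y)) = facetSum k g := by
  induction k generalizing g with
  | zero => rfl
  | succ j ih =>
    simp only [facetSum, antipode_insert]
    rw [ih fun Y => g (insert (j, !true) Y), ih fun Y => g (insert (j, !false) Y), add_comm]
    rfl

theorem sum_erase_insert {k : ℕ} {Y : Finset (ℕ × Bool)} (hY : IsFace k Y) (s : Bool)
    (g : Finset (ℕ × Bool) → ZMod 2) :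
    ∑ v ∈ insert (k, s) Y, g ((insert (k, s) Y).erase v) =
      g Y + ∑ v ∈ Y, g (insert (k, s) (Y.erase v)) := by
  have hk : (k, s) ∉ Y := fun ht => lt_irrefl _ (hY.1 _ ht)
  rw [Finset.sum_insert hk, Finset.erase_insert hk]
  congr 1
  refine Finset.sum_congr rfl fun v hv => ?_
  rw [Finset.erase_insert_of_ne]
  rintro rfl
  exact hk hv

theorem facetSum_boundary (k : ℕ) (g : Finset (ℕ × Bool) → ZMod 2) :
    facetSum k (fun Y => ∑ v ∈ Y, g (Y.erase v)) = 0 := by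
  induction k generalizing g with
  | zero => rfl
  | succ j ih =>
    simp only [facetSum]
    rw [facetSum_congr fun Y hY _ => sum_erase_insert hY true g,
      facetSum_congr fun Y hY _ => sum_erase_insert hY false g, facetSum_add, facetSum_add,
      ih fun Y => g (insert (j, true) Y), ih fun Y => g (insert (j, false) Y), add_zero,
      CharTwo.add_self_eq_zero]

/-- A mod-2 count on faces whose symmetrization is its coboundary has an invariant total over the
facets of cross-polytopes. -/
theorem facetSum_eq_apply_empty {n : ℕ} {q : Finset (ℕ × Bool) → ZMod 2}
    (hq : ∀ Y, IsFace n Y → q Y + q (antipode Y) = ∑ v ∈ Y, q (Y.erase v)) (k : ℕ) (hk : k ≤ n) :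
    facetSum k q = q ∅ := by
  induction k with
  | zero => rfl
  | succ j ih =>
    have hface : ∀ Y, IsFace j Y → IsFace n (insert (j, true) Y) := fun Y hY =>
      ⟨fun v hv => ((hY.insert true).1 v hv).trans_le hk, (hY.insert true).2⟩
    rw [← ih (by omega)]
    simp only [facetSum]
    rw [← facetSum_antipode j fun Y => q (insert (j, false) Y), ← facetSum_add,
      ← add_zero (facetSum j q), ← facetSum_boundary j fun Y => q (insert (j, true) Y),
      ← facetSum_add]
    refine facetSum_congr fun Y hY _ => ?_
    rw [← sum_erase_insert hY true q, ← hq _ (hface Y hY), antipode_insert]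
    rfl

/-- Tucker's lemma for the barycentric subdivision of the boundary of the cross-polytope. -/
theorem octahedral_tucker {n m : ℕ} (lam : Finset (ℕ × Bool) → ℕ)
    (hlow : ∀ Y, IsFace n Y → Y.Nonempty → 2 ≤ lam Y)
    (hup : ∀ Y, IsFace n Y → Y.Nonempty → lam Y < 2 * m + 2)
    (hodd : ∀ Y, IsFace n Y → Y.Nonempty → lam (antipode Y) = oppositeLabel (lam Y))
    (hcompl : ∀ X Y, IsFace n Y → X.Nonempty → X ⊆ Y → lam X ≠ oppositeLabel (lam Y)) :
    n ≤ m := by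
  let Inv : Finset (ℕ × Bool) → Multiset ℕ → Prop := fun Y M =>
    IsFace n Y ∧ ConsistentLabels M ∧ (∀ x ∈ M, 2 ≤ x ∧ x < 2 * m + 2) ∧
      ∀ X, X ⊆ Y → X.Nonempty → ∀ x ∈ M, lam X ≠ oppositeLabel x
  have hInv : ∀ Y M, Inv Y M → ∀ v ∈ Y, Inv (Y.erase v) (lam Y ::ₘ M) := by
    rintro Y M ⟨hY, hM, hb, hc⟩ v hv
    have hne : Y.Nonempty := ⟨v, hv⟩
    refine ⟨hY.mono (Finset.erase_subset _ _), ?_, ?_, ?_⟩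
    · intro x hx hx'
      have hself : ∀ y, oppositeLabel y ≠ y := fun y => by unfold oppositeLabel; omega
      rcases Multiset.mem_cons.1 hx with rfl | hx <;> rcases Multiset.mem_cons.1 hx' with h | h
      · exact hself _ h
      · exact hc Y subset_rfl hne _ h (oppositeLabel_oppositeLabel _).symm
      · exact hc Y subset_rfl hne _ hx h.symm
      · exact hM x hx h
    · intro x hx
      rcases Multiset.mem_cons.1 hx with rfl | hx
      · exact ⟨hlow Y hY hne, hup Y hY hne⟩
      · exact hb x hx
    · intro X hX hXne x hx
      have hXY := hX.trans (Finset.erase_subset _ _)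
      rcases Multiset.mem_cons.1 hx with rfl | hx
      · exact hcompl X Y hY hXne hXY
      · exact hc X hXY hXne x hx
  have hInv0 : ∀ Y, IsFace n Y → Inv Y 0 := fun Y hY =>
    ⟨hY, by simp [ConsistentLabels], by simp, by simp⟩
  let q : Finset (ℕ × Bool) → ZMod 2 := fun Y => flagSum lam labelWeight Y.card Y 0
  have hq : ∀ Y, IsFace n Y → q Y + q (antipode Y) = ∑ v ∈ Y, q (Y.erase v) := by
    intro Y hY
    have h1 := flagSum_antipode hodd labelWeight Y.card Y hY 0
    have h2 := flagSum_boundary lam labelWeight Y.card Y rfl 0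
    simp only [Multiset.map_zero, Multiset.sum_zero, add_zero] at h1 h2
    simp only [q, card_antipode]
    rw [h1, ← flagSum_add, Finset.sum_congr rfl fun v hv => by rw [Finset.card_erase_of_mem hv],
      ← h2]
    exact flagSum_congr Inv hInv (fun M hM => (sum_labelWeight_erase hM.2.1).symm) _ Y rfl 0
      (hInv0 Y hY)
  by_contra! hmn
  have h1 := facetSum_eq_apply_empty hq n le_rfl
  have h2 : facetSum n q = facetSum n fun _ => 0 := by
    refine facetSum_congr fun Y hY hYn => ?_
    rw [← flagSum_zero lam Y.card Y 0]
    refine flagSum_congr (fun Z M => Inv Z M ∧ Z.card + M.card = n) ?_ ?_ _ Y rfl 0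
      ⟨hInv0 Y hY, by simp [hYn]⟩
    · rintro Z M ⟨hZ, hc⟩ v hv
      refine ⟨hInv Z M hZ v hv, ?_⟩
      have := Finset.card_pos.2 ⟨v, hv⟩
      rw [Finset.card_erase_of_mem hv, Multiset.card_cons]
      omega
    · rintro M ⟨hM, hc⟩
      refine labelWeight_eq_zero_of_card hM.2.1 (fun x hx => (hM.2.2.1 x hx).1)
        (fun x hx => (hM.2.2.1 x hx).2) ?_
      simp only [Finset.card_empty, zero_add] at hc
      omega
  have h3 := facetSum_add n (fun _ => 0) (fun _ => 0)
  simp only [add_zero, left_eq_add] at h3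
  have h4 : q ∅ = 1 := labelWeight_zero
  rw [← h1, h2, h3] at h4
  exact zero_ne_one h4

theorem IsFace.card_le {n : ℕ} {Y : Finset (ℕ × Bool)} (hY : IsFace n Y) : Y.card ≤ n := by
  rw [← Finset.card_range n]
  refine Finset.card_le_card_of_injOn Prod.fst (fun v hv => by simpa using hY.1 v hv) ?_
  rintro ⟨i, s⟩ hv ⟨j, t⟩ hw (rfl : i = j)
  have := hY.2 i
  cases s <;> cases t <;> simp_all

/-- The length of the longest sequence of coordinates below `n` along which the signs of `Y`,
twisted by the parities of the coordinates, alternate and which ends with the sign `s`. -/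
def alternation (Y : Finset (ℕ × Bool)) : ℕ → Bool → ℕ
  | 0, _ => 0
  | n + 1, s => if (n, s) ∈ Y then alternation Y n s + 1 else alternation Y n (!s)

theorem alternation_le_succ (Y : Finset (ℕ × Bool)) (n : ℕ) (s : Bool) :
    alternation Y n s ≤ alternation Y n (!s) + 1 := by
  induction n generalizing s with
  | zero => simp [alternation]
  | succ n ih =>
    have h1 := ih s
    have h2 := ih (!s)
    simp only [alternation, Bool.not_not] at *
    split_ifs <;> omega

theorem alternation_mono {X Y : Finset (ℕ × Bool)} (h : X ⊆ Y) (n : ℕ) (s : Bool) :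
    alternation X n s ≤ alternation Y n s := by
  induction n generalizing s with
  | zero => simp [alternation]
  | succ n ih =>
    have h1 := ih s
    have h2 := ih (!s)
    have h3 := alternation_le_succ Y n (!s)
    have h4 := @h (n, s)
    simp only [alternation, Bool.not_not] at *
    split_ifs <;> first | omega | simp_all

theorem alternation_antipode (Y : Finset (ℕ × Bool)) (n : ℕ) (s : Bool) :
    alternation (antipode Y) n s = alternation Y n (!s) := by
  induction n generalizing s with
  | zero => simp [alternation]
  | succ n ih => simp only [alternation, mem_antipode, ih]

theorem alternation_ne {Y : Finset (ℕ × Bool)} (hY : ∀ i, (i, true) ∈ Y → (i, false) ∉ Y) (n : ℕ)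
    (hne : ∃ v ∈ Y, v.1 < n) : alternation Y n true ≠ alternation Y n false := by
  induction n with
  | zero => simp at hne
  | succ n ih =>
    simp only [alternation, Bool.not_true, Bool.not_false]
    have h1 := hY n
    split_ifs with h2 h3 h3
    · exact absurd h3 (h1 h2)
    · omega
    · omega
    · refine (ih ?_).symm
      obtain ⟨⟨i, s⟩, hv, hi⟩ := hne
      refine ⟨_, hv, lt_of_le_of_ne (Nat.lt_succ_iff.1 hi) ?_⟩
      rintro rfl
      cases s <;> contradiction

theorem alternation_le_card (Y : Finset (ℕ × Bool)) (n : ℕ) (s : Bool) :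
    alternation Y n s ≤ (Y.filter fun v => v.1 < n).card := by
  induction n generalizing s with
  | zero => simp [alternation]
  | succ n ih =>
    have hsub : (Y.filter fun v => v.1 < n) ⊆ Y.filter fun v => v.1 < n + 1 :=
      Finset.monotone_filter_right _ fun v _ hv => Nat.lt_succ_of_lt hv
    simp only [alternation]
    split_ifs with h
    · refine (Nat.succ_le_succ (ih s)).trans (Finset.card_lt_card ?_)
      refine Finset.ssubset_iff_subset_ne.2 ⟨hsub, fun heq => ?_⟩
      have : (n, s) ∈ Y.filter fun v => v.1 < n := by rw [heq]; simp [h]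
      simp at this
    · exact (ih _).trans (Finset.card_le_card hsub)

/-- The larger of the two alternation numbers. -/
def maxAlternation (Y : Finset (ℕ × Bool)) (n : ℕ) : ℕ :=
  max (alternation Y n true) (alternation Y n false)

theorem maxAlternation_succ_le (Y : Finset (ℕ × Bool)) (n : ℕ) :
    maxAlternation Y (n + 1) ≤ maxAlternation Y n + 1 := by
  simp only [maxAlternation, alternation, Bool.not_true, Bool.not_false]
  split_ifs <;> omega

theorem maxAlternation_add_le (Y : Finset (ℕ × Bool)) (n k : ℕ) :
    maxAlternation Y (n + k) ≤ maxAlternation Y n + k := by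
  induction k with
  | zero => rfl
  | succ k ih =>
    have := maxAlternation_succ_le Y (n + k)
    rw [← add_assoc]
    omega

theorem maxAlternation_antipode (Y : Finset (ℕ × Bool)) (n : ℕ) :
    maxAlternation (antipode Y) n = maxAlternation Y n := by
  simp only [maxAlternation, alternation_antipode]
  exact max_comm _ _

theorem exists_sign_of_maxAlternation {Y : Finset (ℕ × Bool)}
    (hY : ∀ i, (i, true) ∈ Y → (i, false) ∉ Y) (a k : ℕ)
    (h : maxAlternation Y a + (k + 1) ≤ maxAlternation Y (a + (k + 1))) :
    ∃ s, (∀ l < k + 1, (a + l, s) ∈ Y) ∧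
      alternation Y (a + (k + 1)) (!s) < alternation Y (a + (k + 1)) s := by
  induction k with
  | zero =>
    have h1 := hY a
    simp only [maxAlternation, zero_add, alternation, Bool.not_true, Bool.not_false] at h
    by_cases ht : (a, true) ∈ Y
    · refine ⟨true, by simpa using ht, ?_⟩
      simp [alternation, ht, h1 ht]
    · by_cases hf : (a, false) ∈ Y
      · refine ⟨false, by simpa using hf, ?_⟩
        simp [alternation, ht, hf]
      · simp only [ht, hf, if_false] at h
        omega
  | succ k ih =>
    have h1 := maxAlternation_succ_le Y (a + (k + 1))
    obtain ⟨s, hs, hlt⟩ := ih (by rw [add_assoc] at h1; omega)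
    have hmem : (a + (k + 1), s) ∈ Y := by
      by_contra hn
      have h2 := maxAlternation_add_le Y a (k + 1)
      rw [← add_assoc a (k + 1) 1] at h
      generalize a + (k + 1) = b at h h2 hlt hn
      simp only [maxAlternation, alternation, Bool.not_true, Bool.not_false] at h h2
      cases s <;> simp only [hn, if_false, Bool.not_true, Bool.not_false] at h hlt <;>
        split_ifs at h <;> omega
    have hmem' : (a + (k + 1), !s) ∉ Y := by
      have := hY (a + (k + 1))
      cases s
      · exact fun h => this h hmem
      · exact this hmem
    refine ⟨s, fun l hl => ?_, ?_⟩
    · rcases Nat.lt_succ_iff_lt_or_eq.1 hl with hl | rfl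
      · exact hs l hl
      · exact hmem
    · rw [← add_assoc a (k + 1) 1]
      simp [alternation, hmem, hmem']

theorem exists_block_of_maxAlternation (Y : Finset (ℕ × Bool)) (L D : ℕ)
    (h : D * L < maxAlternation Y (D * L) + D) :
    ∃ b < D, maxAlternation Y (b * L) + L ≤ maxAlternation Y (b * L + L) := by
  by_contra! hb
  have : ∀ b ≤ D, maxAlternation Y (b * L) + b ≤ b * L := by
    intro b hbD
    induction b with
    | zero => simp [maxAlternation, alternation]
    | succ b ih =>
      have h1 := ih (by omega)
      have h2 := hb b (by omega)
      rw [Nat.succ_mul]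
      omega
  have := this D le_rfl
  omega

/-- The real number represented by a sign. -/
def signValue (s : Bool) : ℝ := if s then 1 else -1

theorem abs_signValue (s : Bool) : |signValue s| = 1 := by cases s <;> simp [signValue]

theorem signValue_not (s : Bool) : signValue (!s) = -signValue s := by cases s <;> simp [signValue]

/-- The averages of the signs of `Y` over `D` consecutive blocks of length `L`. -/
noncomputable def blockAverage (D L : ℕ) (Y : Finset (ℕ × Bool)) (b : Fin D) : ℝ :=
  (∑ v ∈ Y, if v.1 / L = b then signValue v.2 else 0) / L

theorem blockAverage_antipode (D L : ℕ) (Y : Finset (ℕ × Bool)) :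
    blockAverage D L (antipode Y) = -blockAverage D L Y := by
  ext b
  simp only [blockAverage, antipode, Finset.sum_map, Pi.neg_apply, ← neg_div,
    ← Finset.sum_neg_distrib]
  congr 1
  refine Finset.sum_congr rfl fun v _ => ?_
  have h1 : (flipSign.toEmbedding v).1 = v.1 := rfl
  have h2 : (flipSign.toEmbedding v).2 = !v.2 := rfl
  rw [h1, h2, signValue_not]
  split_ifs <;> simp

theorem abs_sum_signValue_le (L b : ℕ) (Y : Finset (ℕ × Bool)) :
    |∑ v ∈ Y, if v.1 / L = b then signValue v.2 else 0| ≤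
      (Y.filter fun v => v.1 / L = b).card := by
  rw [← Finset.sum_filter]
  refine (Finset.abs_sum_le_sum_abs _ _).trans ?_
  simp [abs_signValue]

theorem dist_blockAverage_le (D L : ℕ) {X Y : Finset (ℕ × Bool)} (h : X ⊆ Y) :
    dist (blockAverage D L X) (blockAverage D L Y) ≤ (Y \ X).card / L := by
  refine (dist_pi_le_iff (by positivity)).2 fun b => ?_
  rw [dist_comm, Real.dist_eq, blockAverage, blockAverage, ← Finset.sum_sdiff h, ← sub_div,
    add_sub_cancel_right, abs_div, Nat.abs_cast]
  gcongr
  refine (abs_sum_signValue_le _ _ _).trans ?_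
  exact_mod_cast Finset.card_filter_le _ _

theorem norm_blockAverage {D L : ℕ} (hL : 0 < L) {Y : Finset (ℕ × Bool)}
    (hY : IsFace (D * L) Y) (h : D * L < maxAlternation Y (D * L) + D) :
    ‖blockAverage D L Y‖ = 1 := by
  have hL' : (0 : ℝ) < L := by exact_mod_cast hL
  apply le_antisymm
  · refine (pi_norm_le_iff_of_nonneg zero_le_one).2 fun b => ?_
    rw [Real.norm_eq_abs, blockAverage, abs_div, Nat.abs_cast, div_le_one hL']
    refine (abs_sum_signValue_le _ _ _).trans ?_
    have hsub : IsFace (D * L) (Y.filter fun v => v.1 / L = b) := hY.mono (Finset.filter_subset _ _)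
    have : (Y.filter fun v => v.1 / L = b).card ≤ (Finset.range L).card := by
      refine Finset.card_le_card_of_injOn (fun v => v.1 % L)
        (fun v _ => by simpa using Nat.mod_lt _ hL) ?_
      rintro ⟨i, s⟩ hv ⟨j, t⟩ hw (hij : i % L = j % L)
      have hv' := (Finset.mem_filter.1 hv).2
      have hw' := (Finset.mem_filter.1 hw).2
      have : i = j := by
        rw [← Nat.div_add_mod i L, ← Nat.div_add_mod j L, hij]
        simp only at hv' hw'
        rw [hv', hw']
      subst this
      have := hsub.2 i
      cases s <;> cases t <;> simp_all
    rw [Finset.card_range] at this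
    exact_mod_cast this
  · obtain ⟨b, hb, hbl⟩ := exists_block_of_maxAlternation Y L D h
    obtain ⟨k, rfl⟩ := Nat.exists_eq_succ_of_ne_zero hL.ne'
    obtain ⟨s, hs, -⟩ := exists_sign_of_maxAlternation hY.2 _ k hbl
    have heq : (Y.filter fun v => v.1 / (k + 1) = b) =
        (Finset.range (k + 1)).image fun l => (b * (k + 1) + l, s) := by
      ext ⟨i, t⟩
      simp only [Finset.mem_filter, Finset.mem_image, Finset.mem_range, Prod.mk.injEq]
      constructor
      · rintro ⟨hi, hib⟩
        have hdm := Nat.div_add_mod i (k + 1)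
        rw [hib, mul_comm] at hdm
        refine ⟨i % (k + 1), Nat.mod_lt _ hL, hdm, ?_⟩
        have h1 := hs _ (Nat.mod_lt i hL)
        rw [hdm] at h1
        have := hY.2 i
        cases s <;> cases t <;> simp_all
      · rintro ⟨l, hl, rfl, rfl⟩
        refine ⟨hs l hl, ?_⟩
        rw [mul_comm, Nat.mul_add_div (Nat.succ_pos k), Nat.div_eq_of_lt hl, add_zero]
    have h1 : blockAverage D (k + 1) Y ⟨b, hb⟩ = signValue s := by
      rw [blockAverage, ← Finset.sum_filter, heq, Finset.sum_image (by intro; simp)]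
      simp only [Finset.sum_const, Finset.card_range, nsmul_eq_mul]
      exact mul_div_cancel_left₀ _ hL'.ne'
    rw [← abs_signValue s, ← h1, ← Real.norm_eq_abs]
    exact norm_le_pi_norm _ _

/-- The Borsuk–Ulam theorem, for spheres of the supremum norm. -/
theorem borsuk_ulam {D m : ℕ} (F : (Fin D → ℝ) → Fin m → ℝ)
    (hF : ContinuousOn F (Metric.sphere 0 1)) (hodd : ∀ w ∈ Metric.sphere 0 1, F (-w) = -F w)
    (hne : ∀ w ∈ Metric.sphere 0 1, F w ≠ 0) : D ≤ m := by
  classical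
  rcases Nat.eq_zero_or_pos D with rfl | hD
  · exact Nat.zero_le _
  have hcomp : IsCompact (Metric.sphere (0 : Fin D → ℝ) 1) := isCompact_sphere _ _
  have hsph : (Metric.sphere (0 : Fin D → ℝ) 1).Nonempty :=
    ⟨fun _ => 1, by
      have : Nonempty (Fin D) := ⟨⟨0, hD⟩⟩
      simp⟩
  obtain ⟨w₀, hw₀, hmin⟩ := hcomp.exists_isMinOn hsph hF.norm
  set c := ‖F w₀‖ with hc
  have hc0 : 0 < c := norm_pos_iff.2 (hne w₀ hw₀)
  have : Nonempty (Fin m) := by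
    by_contra hemp
    rw [not_nonempty_iff] at hemp
    exact hne w₀ hw₀ (Subsingleton.elim _ _)
  obtain ⟨δ, hδ, hunif⟩ := Metric.uniformContinuousOn_iff.1
    (hcomp.uniformContinuousOn_of_continuous hF) c hc0
  obtain ⟨L, hL⟩ := exists_nat_gt (D / δ)
  have hL0 : (0 : ℝ) < L := lt_of_le_of_lt (by positivity) hL
  have hLpos : 0 < L := by exact_mod_cast hL0
  have hDL : D ≤ D * L := Nat.le_mul_of_pos_right _ hLpos
  choose idx hidx using fun a : Fin m → ℝ => Finite.exists_max a
  let W : Finset (ℕ × Bool) → Fin m → ℝ := fun Y => F (blockAverage D L Y)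
  let J : Finset (ℕ × Bool) → Fin m := fun Y => idx fun i => |W Y i|
  have hJ : ∀ Y, IsFace (D * L) Y → D * L < maxAlternation Y (D * L) + D →
      c ≤ |W Y (J Y)| := by
    intro Y hY h
    have h1 : c ≤ ‖W Y‖ := hmin (by simpa using norm_blockAverage hLpos hY h)
    refine h1.trans ((pi_norm_le_iff_of_nonneg (abs_nonneg _)).2 fun i => ?_)
    exact hidx (fun i => |W Y i|) i
  have hclose : ∀ X Y, IsFace (D * L) Y → X ⊆ Y → D * L < maxAlternation X (D * L) + D →
      D * L < maxAlternation Y (D * L) + D → ∀ i, |W X i - W Y i| < c := by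
    intro X Y hY hXY hX hYm i
    rw [← Real.dist_eq]
    refine (dist_le_pi_dist _ _ i).trans_lt (hunif _ ?_ _ ?_ ?_)
    · simpa using norm_blockAverage hLpos (hY.mono hXY) hX
    · simpa using norm_blockAverage hLpos hY hYm
    · refine (dist_blockAverage_le D L hXY).trans_lt ?_
      rw [div_lt_comm₀ hL0 hδ]
      refine lt_of_le_of_lt ?_ hL
      gcongr
      have h1 : maxAlternation X (D * L) ≤ X.card :=
        (max_le (alternation_le_card _ _ _) (alternation_le_card _ _ _)).trans
          (Finset.card_filter_le _ _)
      have h2 := hY.card_le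
      rw [Finset.card_sdiff_of_subset hXY]
      omega
  have hWodd : ∀ Y, IsFace (D * L) Y → D * L < maxAlternation Y (D * L) + D →
      W (antipode Y) = -W Y := fun Y hY h => by
    simp only [W, blockAverage_antipode]
    exact hodd _ (by simpa using norm_blockAverage hLpos hY h)
  have hJodd : ∀ Y, IsFace (D * L) Y → D * L < maxAlternation Y (D * L) + D →
      J (antipode Y) = J Y := fun Y hY h => by
    simp only [J, hWodd Y hY h, Pi.neg_apply, abs_neg]
  let lam : Finset (ℕ × Bool) → ℕ := fun Y =>
    if D * L < maxAlternation Y (D * L) + D then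
      2 * (D * L - D + 1 + J Y) + if 0 < W Y (J Y) then 1 else 0
    else 2 * maxAlternation Y (D * L) +
      if alternation Y (D * L) false < alternation Y (D * L) true then 1 else 0
  have hneq : ∀ Y, IsFace (D * L) Y → Y.Nonempty →
      alternation Y (D * L) true ≠ alternation Y (D * L) false := fun Y hY ⟨v, hv⟩ =>
    alternation_ne hY.2 _ ⟨v, hv, hY.1 v hv⟩
  have key : D * L ≤ D * L - D + m := by
    refine octahedral_tucker lam ?_ ?_ ?_ ?_
    · intro Y hY hne
      have := hneq Y hY hne
      have hmax : maxAlternation Y (D * L) = max _ _ := rfl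
      simp only [lam]
      split_ifs <;> omega
    · intro Y hY hne
      have := (J Y).2
      simp only [lam]
      split_ifs <;> omega
    · intro Y hY hne
      have h1 := hneq Y hY hne
      by_cases h : D * L < maxAlternation Y (D * L) + D
      · have h2 := hJ Y hY h
        have h3 : W Y (J Y) ≠ 0 := fun h0 => by rw [h0, abs_zero] at h2; linarith
        simp only [lam, maxAlternation_antipode, if_pos h, hJodd Y hY h, hWodd Y hY h,
          Pi.neg_apply, Left.neg_pos_iff, oppositeLabel]
        rcases lt_or_gt_of_ne h3 with h3 | h3
        · rw [if_pos h3, if_neg h3.not_gt]; omega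
        · rw [if_neg h3.not_gt, if_pos h3]; omega
      · simp only [lam, maxAlternation_antipode, if_neg h, alternation_antipode, oppositeLabel,
          Bool.not_true, Bool.not_false]
        split_ifs <;> omega
    · intro X Y hY hXne hXY heq
      have hX := hY.mono hXY
      have h1 := hneq X hX hXne
      have h2 := hneq Y hY (hXne.mono hXY)
      have h3 := alternation_mono hXY (D * L) true
      have h4 := alternation_mono hXY (D * L) false
      simp only [lam, oppositeLabel] at heq
      by_cases hXm : D * L < maxAlternation X (D * L) + D
      · have hYm : D * L < maxAlternation Y (D * L) + D := by
          simp only [maxAlternation] at hXm ⊢; omega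
        simp only [if_pos hXm, if_pos hYm] at heq
        have hJXY : J X = J Y := by
          apply Fin.ext
          split_ifs at heq <;> omega
        have h5 := hJ X hX hXm
        have h6 := hJ Y hY hYm
        have h7 := hclose X Y hY hXY hXm hYm (J Y)
        rw [hJXY] at heq h5
        rw [abs_lt] at h7
        by_cases hx : 0 < W X (J Y) <;> by_cases hy : 0 < W Y (J Y)
        · simp only [hx, hy, if_true] at heq; omega
        · rw [abs_of_pos hx] at h5
          linarith
        · rw [abs_of_pos hy] at h6
          linarith
        · simp only [hx, hy, if_false] at heq; omega
      · simp only [if_neg hXm] at heq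
        by_cases hYm : D * L < maxAlternation Y (D * L) + D
        · simp only [if_pos hYm] at heq
          split_ifs at heq <;> omega
        · simp only [if_neg hYm] at heq
          have hmaxX : maxAlternation X (D * L) = max _ _ := rfl
          have hmaxY : maxAlternation Y (D * L) = max _ _ := rfl
          split_ifs at heq <;> omega
  omega

/-- `GenusLE m A`: there is a continuous odd map from the ambient space to `ℝᵐ` without zeros
on `A`; for closed symmetric `A` this says that the Krasnoselskii genus is at most `m`. -/
def GenusLE {X : Type*} [TopologicalSpace X] [Neg X] (m : ℕ) (A : Set X) : Prop :=
  ∃ f : Fin m → X → ℝ, (∀ i, Continuous (f i)) ∧ (∀ i x, f i (-x) = -f i x) ∧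
    ∀ x ∈ A, ∃ i, f i x ≠ 0

section Genus

variable {X : Type*} [TopologicalSpace X] [Neg X]

theorem GenusLE.mono {m : ℕ} {A B : Set X} (h : GenusLE m B) (hAB : A ⊆ B) : GenusLE m A := by
  obtain ⟨f, hf, ho, hn⟩ := h
  exact ⟨f, hf, ho, fun x hx => hn x (hAB hx)⟩

theorem GenusLE.union {m n : ℕ} {A B : Set X} (hA : GenusLE m A) (hB : GenusLE n B) :
    GenusLE (m + n) (A ∪ B) := by
  obtain ⟨f, hf, fo, fn⟩ := hA
  obtain ⟨g, hg, go, gn⟩ := hB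
  refine ⟨Fin.append f g, fun i => ?_, fun i => ?_, ?_⟩
  · refine Fin.addCases (fun i => ?_) (fun i => ?_) i
    · simpa using hf i
    · simpa using hg i
  · refine Fin.addCases (fun i => ?_) (fun i => ?_) i
    · simpa using fo i
    · simpa using go i
  · rintro x (hx | hx)
    · obtain ⟨i, hi⟩ := fn x hx
      exact ⟨Fin.castAdd n i, by simpa using hi⟩
    · obtain ⟨i, hi⟩ := gn x hx
      exact ⟨Fin.natAdd m i, by simpa using hi⟩

end Genus

theorem GenusLE.of_odd_map {X : Type*} [NormedAddCommGroup X] {m : ℕ} {A B : Set X}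
    (hB : IsClosed B) (hs : ∀ x ∈ B, -x ∈ B)
    (g : C(B, X)) (hg : ∀ x : B, g ⟨-x, hs x x.2⟩ = -g x) (hA : GenusLE m A)
    (hgA : ∀ x, g x ∈ A) : GenusLE m B := by
  obtain ⟨f, hf, fo, fn⟩ := hA
  have key : ∀ i, ∃ h : C(X, ℝ), h.restrict B = (⟨f i, hf i⟩ : C(X, ℝ)).comp g :=
    fun i => ContinuousMap.exists_restrict_eq hB _
  choose h hh using key
  have hv : ∀ i (x : B), h i x = f i (g x) := fun i x => DFunLike.congr_fun (hh i) x
  refine ⟨fun i x => (h i x - h i (-x)) / 2, fun i => by fun_prop, fun i x => by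
    simp only [neg_neg]; ring, fun x hx => ?_⟩
  obtain ⟨i, hi⟩ := fn _ (hgA ⟨x, hx⟩)
  refine ⟨i, ?_⟩
  have h1 := hv i ⟨x, hx⟩
  have h2 := hv i ⟨-x, hs x hx⟩
  rw [hg ⟨x, hx⟩, fo] at h2
  simp only at h1 h2
  intro h3
  simp only [h1, h2] at h3
  apply hi
  linarith

section Genus

variable {X : Type*} [NormedAddCommGroup X] [NormedSpace ℝ X]

theorem exists_genusLE_of_isCompact {K : Set X} (hK : IsCompact K) (h0 : (0 : X) ∉ K) :
    ∃ m, GenusLE m K := by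
  obtain ⟨t, ht⟩ := hK.elim_finite_subcover (fun l : X →L[ℝ] ℝ => {x | l x ≠ 0})
    (fun l => isOpen_ne_fun l.continuous continuous_const) (fun x hx => by
      obtain ⟨l, hl⟩ := SeparatingDual.exists_ne_zero (R := ℝ) (x := x)
        (by rintro rfl; exact h0 hx)
      exact Set.mem_iUnion.2 ⟨l, hl⟩)
  refine ⟨t.card, fun i => (t.equivFin.symm i : X →L[ℝ] ℝ),
    fun i => ContinuousLinearMap.continuous _, fun i x => map_neg _ _, fun x hx => ?_⟩
  obtain ⟨l, hlt, hl⟩ := Set.mem_iUnion₂.1 (ht hx)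
  exact ⟨t.equivFin ⟨l, hlt⟩, by simpa using hl⟩

theorem le_of_genusLE_sphere {m k : ℕ} {W : Submodule ℝ X} (hW : Module.finrank ℝ W = k)
    (hk : 1 ≤ k) {ρ : ℝ} (hρ : 0 < ρ) (h : GenusLE m {u : X | u ∈ W ∧ ‖u‖ = ρ}) : k ≤ m := by
  obtain ⟨f, hf, fo, fn⟩ := h
  have hfd : FiniteDimensional ℝ W := Module.finite_of_finrank_pos (by omega)
  let e : (Fin k → ℝ) ≃L[ℝ] W :=
    ContinuousLinearEquiv.ofFinrankEq (by simp [hW])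
  have he : ∀ w ∈ Metric.sphere (0 : Fin k → ℝ) 1, ‖(e w : X)‖ ≠ 0 := by
    intro w hw h0
    have h1 : e w = 0 := by simpa using h0
    have h2 : w = 0 := by simpa using h1
    simp [h2] at hw
  refine borsuk_ulam (fun w i => f i ((ρ / ‖(e w : X)‖) • (e w : X))) ?_ ?_ ?_
  · refine continuousOn_pi.2 fun i => (hf i).comp_continuousOn ?_
    have hc : Continuous fun w => (e w : X) := continuous_subtype_val.comp e.continuous
    exact (continuousOn_const.div hc.norm.continuousOn he).smul hc.continuousOn
  · intro w _
    ext i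
    simp [fo]
  · intro w hw h0
    obtain ⟨i, hi⟩ := fn ((ρ / ‖(e w : X)‖) • (e w : X)) ⟨W.smul_mem _ (e w).2, by
      rw [norm_smul, norm_div, norm_norm, div_mul_cancel₀ _ (he w hw), Real.norm_of_nonneg hρ.le]⟩
    exact hi (congrFun h0 i)

end Genus

theorem exists_ekeland_point {E : Type*} [MetricSpace E] [CompleteSpace E] {Ψ : E → ℝ}
    (hΨ : Continuous Ψ) (hb : BddBelow (Set.range Ψ)) {l : ℝ} (hl : 0 < l) (g₀ : E) :
    ∃ g, Ψ g + l * dist g₀ g ≤ Ψ g₀ ∧ ∀ g', Ψ g ≤ Ψ g' + l * dist g g' := by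
  let S : E → Set E := fun g => {h | Ψ h + l * dist g h ≤ Ψ g}
  have hself : ∀ g, g ∈ S g := fun g => by simp [S]
  have htrans : ∀ {a b c}, b ∈ S a → c ∈ S b → c ∈ S a := by
    intro a b c hab hbc
    simp only [S, Set.mem_ofPred_eq] at *
    have := mul_le_mul_of_nonneg_left (dist_triangle a b c) hl.le
    linarith
  have hSb : ∀ g, BddBelow (Ψ '' S g) := fun g => hb.mono (Set.image_subset_range _ _)
  have hnext : ∀ (n : ℕ) (g : E), ∃ h ∈ S g, Ψ h < sInf (Ψ '' S g) + 1 / ((n : ℝ) + 1) := by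
    intro n g
    obtain ⟨_, ⟨h, hh, rfl⟩, hlt⟩ := exists_lt_of_csInf_lt (Set.Nonempty.image Ψ ⟨g, hself g⟩)
      (lt_add_of_pos_right (sInf (Ψ '' S g)) (Nat.one_div_pos_of_nat (α := ℝ) (n := n)))
    exact ⟨h, hh, hlt⟩
  choose nx hnx hnx' using hnext
  let g : ℕ → E := fun n => Nat.rec g₀ (fun n x => nx n x) n
  have hg : ∀ n, g (n + 1) = nx n (g n) := fun n => rfl
  have hmem : ∀ {n m}, n ≤ m → g m ∈ S (g n) := by
    intro n m hnm
    induction m, hnm using Nat.le_induction with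
    | base => exact hself _
    | succ m _ ih => exact htrans ih (by rw [hg]; exact hnx _ _)
  have hdist : ∀ n, ∀ h ∈ S (g (n + 1)), dist (g (n + 1)) h ≤ 1 / ((n : ℝ) + 1) / l := by
    intro n h hh
    have h1 : sInf (Ψ '' S (g n)) ≤ Ψ h :=
      csInf_le (hSb _) ⟨h, htrans (hmem (Nat.le_succ n)) hh, rfl⟩
    have h2 := hnx' n (g n)
    rw [← hg] at h2
    simp only [S, Set.mem_ofPred_eq] at hh
    rw [le_div_iff₀ hl]
    linarith
  have hlim0 : Tendsto (fun n : ℕ => 1 / ((n : ℝ) + 1) / l) atTop (nhds 0) := by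
    simpa using (tendsto_one_div_add_atTop_nhds_zero_nat (𝕜 := ℝ)).div_const l
  have hcauchy : CauchySeq (fun n => g (n + 1)) := by
    refine cauchySeq_of_le_tendsto_0 (fun n : ℕ => 2 * (1 / ((n : ℝ) + 1) / l)) ?_
      (by simpa using hlim0.const_mul 2)
    intro n m N hn hm
    have h1 := hdist N _ (hmem (Nat.succ_le_succ hn))
    have h2 := hdist N _ (hmem (Nat.succ_le_succ hm))
    have h3 := dist_triangle_left (g (n + 1)) (g (m + 1)) (g (N + 1))
    simp only [Nat.succ_eq_add_one] at h1 h2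
    linarith
  obtain ⟨x, hx⟩ := cauchySeq_tendsto_of_complete hcauchy
  have hclosed : ∀ a, IsClosed (S a) := fun a =>
    isClosed_le (by fun_prop) continuous_const
  have hxmem : ∀ n, x ∈ S (g n) := fun n =>
    (hclosed _).mem_of_tendsto hx (eventually_atTop.2 ⟨n, fun m hm => hmem (Nat.le_succ_of_le hm)⟩)
  refine ⟨x, hxmem 0, fun g' => ?_⟩
  by_contra! hlt
  have hg' : g' ∈ S x := hlt.le
  have hx' : Tendsto (fun n => g (n + 1)) atTop (nhds g') := by
    rw [tendsto_iff_dist_tendsto_zero]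
    exact squeeze_zero (fun _ => dist_nonneg)
      (fun n => hdist n g' (htrans (hxmem (n + 1)) hg')) hlim0
  have := tendsto_nhds_unique hx hx'
  subst this
  simp at hlt

section Deformation

variable {X : Type*} [NormedAddCommGroup X] [NormedSpace ℝ X] {J : X → ℝ}

theorem fderiv_neg_of_even (hJ : Differentiable ℝ J) (heven : ∀ u, J (-u) = J u) (u : X) :
    fderiv ℝ J (-u) = -fderiv ℝ J u := by
  have h1 : HasFDerivAt (fun x => J (-x))
      ((fderiv ℝ J (-u)).comp (-ContinuousLinearMap.id ℝ X)) u :=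
    (hJ (-u)).hasFDerivAt.comp u (hasFDerivAt_id u).neg
  simp only [heven] at h1
  rw [h1.fderiv]
  ext v
  simp

theorem exists_odd_pseudogradient (hJ : ContDiff ℝ 1 J) (heven : ∀ u, J (-u) = J u)
    {Z : Set X} (hZ : IsClosed Z) (hZs : ∀ x ∈ Z, -x ∈ Z) {σ : ℝ} (hσ : 0 < σ)
    (hZσ : ∀ u ∈ Z, σ ≤ ‖fderiv ℝ J u‖) :
    ∃ V : X → X, Continuous V ∧ (∀ u, V (-u) = -V u) ∧ (∀ u, ‖V u‖ ≤ 1) ∧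
      ∀ u ∈ Z, σ / 2 ≤ fderiv ℝ J u (V u) := by
  have hc : Continuous (fderiv ℝ J) := hJ.continuous_fderiv one_ne_zero
  obtain ⟨v, hv⟩ := exists_continuous_forall_mem_convex_of_local_const
    (t := fun u => {v : X | ‖v‖ ≤ 1 ∧ (u ∈ Z → σ / 2 ≤ fderiv ℝ J u v)}) (fun u => by
      intro a ha b hb s t hs ht hst
      refine ⟨?_, fun hu => ?_⟩
      · calc ‖s • a + t • b‖ ≤ s * ‖a‖ + t * ‖b‖ := by
              refine (norm_add_le _ _).trans ?_
              rw [norm_smul, norm_smul, Real.norm_of_nonneg hs, Real.norm_of_nonneg ht]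
          _ ≤ 1 := by nlinarith [ha.1, hb.1]
      · have h1 := ha.2 hu
        have h2 := hb.2 hu
        simp only [map_add, map_smul, smul_eq_mul]
        nlinarith) (fun u => by
      by_cases hu : u ∈ Z
      · obtain ⟨x, hx, hlt⟩ := (fderiv ℝ J u).exists_lt_apply_of_lt_opNorm
          (show σ / 2 < ‖fderiv ℝ J u‖ by linarith [hZσ u hu])
        obtain ⟨y, hy, hlt⟩ : ∃ y : X, ‖y‖ ≤ 1 ∧ σ / 2 < fderiv ℝ J u y := by
          rcases lt_abs.1 hlt with h | h
          · exact ⟨x, hx.le, h⟩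
          · exact ⟨-x, by simpa using hx.le, by simpa using h⟩
        have hcy : Continuous fun z => fderiv ℝ J z y := by fun_prop
        refine ⟨y, (hcy.continuousAt.eventually (lt_mem_nhds hlt)).mono fun z hz =>
          ⟨hy, fun _ => hz.le⟩⟩
      · exact ⟨0, (hZ.isOpen_compl.eventually_mem hu).mono fun z hz =>
          ⟨by simp, fun h => absurd h hz⟩⟩)
  have ho := fderiv_neg_of_even (hJ.differentiable one_ne_zero) heven
  refine ⟨fun x => (1 / 2 : ℝ) • (v x - v (-x)), by fun_prop, fun u => ?_, fun u => ?_,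
    fun u hu => ?_⟩
  · simp only [neg_neg]
    rw [← smul_neg, neg_sub]
  · rw [norm_smul]
    have := norm_sub_le (v u) (v (-u))
    have h1 := (hv u).1
    have h2 := (hv (-u)).1
    norm_num
    linarith
  · have h1 := (hv u).2 hu
    have h2 := (hv (-u)).2 (hZs u hu)
    rw [ho, neg_apply] at h2
    simp only [map_smul, map_sub, smul_eq_mul]
    linarith

theorem eventually_forall_le_sub_of_isCompact (hJ : ContDiff ℝ 1 J) {C : Set X} (hC : IsCompact C)
    {Z : Set X} (hZ : IsClosed Z) {σ : ℝ} (hσ : 0 < σ) {V : X → X} (hV : Continuous V)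
    (hV1 : ∀ u, ‖V u‖ ≤ 1) (hVZ : ∀ u ∈ Z, σ / 2 ≤ fderiv ℝ J u (V u)) :
    ∀ᶠ t : ℝ in nhds 0, ∀ u ∈ C, 0 ≤ t → u ∈ Z → J (u - t • V u) ≤ J u - t * (σ / 4) := by
  refine hC.eventually_forall_of_forall_eventually fun u₀ _ => ?_
  by_cases hu : u₀ ∈ Z
  swap
  · have : ∀ᶠ z : ℝ × X in nhds (0, u₀), z.2 ∉ Z :=
      continuous_snd.continuousAt.eventually
        (hZ.isOpen_compl.eventually_mem (show u₀ ∈ Zᶜ from hu))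
    exact this.mono fun z hz _ h => absurd h hz
  have hs := (hJ.contDiffAt (x := u₀)).hasStrictFDerivAt one_ne_zero
  have h1 := hs.isLittleO.def (show 0 < σ / 8 by linarith)
  have hmap : Tendsto (fun z : ℝ × X => (z.2 - z.1 • V z.2, z.2)) (nhds (0, u₀))
      (nhds (u₀, u₀)) := by
    have hcont : Continuous (fun z : ℝ × X => (z.2 - z.1 • V z.2, z.2)) := by fun_prop
    simpa using hcont.tendsto (0, u₀)
  have h2 : ∀ᶠ z : ℝ × X in nhds (0, u₀), 3 * σ / 8 < fderiv ℝ J u₀ (V z.2) := by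
    have hcont : Continuous (fun z : ℝ × X => fderiv ℝ J u₀ (V z.2)) := by fun_prop
    exact hcont.continuousAt.eventually (lt_mem_nhds (by linarith [hVZ u₀ hu]))
  filter_upwards [hmap.eventually h1, h2] with z hz1 hz2 ht _
  simp only [sub_sub_cancel_left, map_neg, map_smul, smul_eq_mul, norm_neg, norm_smul,
    Real.norm_of_nonneg ht] at hz1
  have h3 := (abs_le.1 (Real.norm_eq_abs _ ▸ hz1)).2
  have h4 := hV1 z.2
  nlinarith [mul_le_mul_of_nonneg_left h4 ht, mul_le_mul_of_nonneg_left hz2.le ht]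

theorem eventually_forall_lt_of_isCompact (hJ : Continuous J) {C : Set X} (hC : IsCompact C)
    {V : X → X} (hV : Continuous V) {η : ℝ} (hη : 0 < η) :
    ∀ᶠ t : ℝ in nhds 0, ∀ u ∈ C, J (u - t • V u) < J u + η := by
  refine hC.eventually_forall_of_forall_eventually fun u₀ _ => ?_
  have h1 : Continuous fun z : ℝ × X => J (z.2 - z.1 • V z.2) - J z.2 := by fun_prop
  have h2 : J (u₀ - (0 : ℝ) • V u₀) - J u₀ < η := by simpa using hη
  exact (h1.continuousAt (x := ((0 : ℝ), u₀)).eventually (gt_mem_nhds h2)).mono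
    fun z hz => by linarith

theorem exists_odd_deformation [CompleteSpace X] (hJ : ContDiff ℝ 1 J)
    (heven : ∀ u, J (-u) = J u) (hbdd : BddBelow (Set.range J)) {B : Set X} (hB : IsCompact B)
    (hBs : ∀ x ∈ B, -x ∈ B) {U : Set X} (hU : IsOpen U) (hUs : ∀ x ∈ U, -x ∈ U)
    {c ε σ r : ℝ} (hε : 0 < ε) (hσ : 0 < σ) (hBc : ∀ x ∈ B, J x ≤ c + ε)
    (hBU : ∀ x ∈ B, ∀ u, dist u x ≤ r → u ∉ U)
    (hnc : ∀ u, u ∉ U → |J u - c| ≤ 2 * ε → σ ≤ ‖fderiv ℝ J u‖) (hr : 16 * ε ≤ σ * r) :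
    ∃ g : C(B, X), (∀ x : B, g ⟨-x, hBs x x.2⟩ = -g x) ∧ ∀ x, J (g x) ≤ c - ε := by
  rcases isEmpty_or_nonempty B with hemp | hne
  · exact ⟨⟨Subtype.val, continuous_subtype_val⟩, fun x => rfl, fun x => isEmptyElim x⟩
  by_contra! hcon
  have hcomp : CompactSpace B := isCompact_iff_compactSpace.1 hB
  have hJc : Continuous J := hJ.continuous
  let E : Set C(B, X) := ⋂ x : B, {g | g ⟨-x, hBs x x.2⟩ = -g x}
  have hE : IsClosed E := isClosed_iInter fun x =>
    isClosed_eq (continuous_eval_const _) (continuous_eval_const _).neg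
  have hEc : CompleteSpace E := hE.completeSpace_coe
  have hEmem : ∀ {g : C(B, X)}, g ∈ E ↔ ∀ x : B, g ⟨-x, hBs x x.2⟩ = -g x := Set.mem_iInter
  let Ψ : E → ℝ := fun g => sSup ((fun x : B => J (g.1 x)) '' Set.univ)
  have hΨ : Continuous Ψ := isCompact_univ.continuous_sSup
    (f := fun (g : E) (x : B) => J (g.1 x)) (hJc.comp
      (continuous_eval.comp (continuous_subtype_val.prodMap continuous_id)))
  have hle : ∀ (g : E) (x : B), J (g.1 x) ≤ Ψ g := fun g x =>
    le_csSup (isCompact_univ.image (hJc.comp g.1.continuous)).bddAbove ⟨x, Set.mem_univ _, rfl⟩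
  have hsup : ∀ (g : E) (M : ℝ), (∀ x : B, J (g.1 x) ≤ M) → Ψ g ≤ M := fun g M h =>
    csSup_le (Set.univ_nonempty.image _) (by rintro _ ⟨x, -, rfl⟩; exact h x)
  have hΨb : BddBelow (Set.range Ψ) := by
    obtain ⟨M, hM⟩ := hbdd
    refine ⟨M, ?_⟩
    rintro _ ⟨g, rfl⟩
    obtain ⟨x⟩ := hne
    exact (hM ⟨g.1 x, rfl⟩).trans (hle g x)
  let g₀ : E := ⟨⟨Subtype.val, continuous_subtype_val⟩, hEmem.2 fun x => rfl⟩
  obtain ⟨g, hg1, hg2⟩ := exists_ekeland_point hΨ hΨb (show 0 < σ / 8 by linarith) g₀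
  have hg₀ : Ψ g₀ ≤ c + ε := hsup _ _ fun x => hBc x x.2
  have hgo := hEmem.1 g.2
  have hgl : c - ε < Ψ g := by
    obtain ⟨x, hx⟩ := hcon g.1 hgo
    exact hx.trans_le (hle g x)
  have hd : dist g₀ g ≤ r := by nlinarith
  have hgU : ∀ x, g.1 x ∉ U := fun x => hBU x x.2 _ <| by
    rw [dist_comm]
    exact (ContinuousMap.dist_apply_le_dist (f := g₀.1) (g := g.1) x).trans hd
  have hgu : Ψ g ≤ c + ε := by nlinarith [dist_nonneg (x := g₀) (y := g)]
  let Z : Set X := {u | u ∉ U ∧ |J u - c| ≤ 2 * ε}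
  have hZ : IsClosed Z := hU.isClosed_compl.inter
    (isClosed_le (hJc.sub continuous_const).abs continuous_const)
  obtain ⟨V, hVc, hVo, hV1, hVZ⟩ := exists_odd_pseudogradient hJ heven hZ
    (fun x hx => ⟨fun h => hx.1 (by simpa using hUs _ h), by rw [heven]; exact hx.2⟩) hσ
    (fun u hu => hnc u hu.1 hu.2)
  have hC : IsCompact (Set.range g.1) := isCompact_range g.1.continuous
  have hev := (eventually_forall_le_sub_of_isCompact hJ hC hZ hσ hVc hV1 hVZ).and
    ((eventually_forall_lt_of_isCompact hJc hC hVc (half_pos hε)).and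
      (gt_mem_nhds (show 0 < ε / σ by positivity)))
  obtain ⟨t, ⟨ht1, ht2, ht3⟩, ht : 0 < t⟩ := ((hev.filter_mono nhdsWithin_le_nhds).and
    (self_mem_nhdsWithin (s := Set.Ioi (0 : ℝ)))).exists
  rw [lt_div_iff₀ hσ] at ht3
  let g' : E := ⟨⟨fun x => g.1 x - t • V (g.1 x), by fun_prop⟩, hEmem.2 fun x => by
    simp only [ContinuousMap.coe_mk, hgo, hVo, smul_neg]
    abel⟩
  have hdist : dist g g' ≤ t := (ContinuousMap.dist_le (f := g.1) (g := g'.1) ht.le).2 fun x => by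
    simp only [g', ContinuousMap.coe_mk, dist_self_sub_right, norm_smul, Real.norm_of_nonneg ht.le]
    exact mul_le_of_le_one_right ht.le (hV1 _)
  have hdesc : Ψ g' ≤ Ψ g - t * (σ / 4) := hsup _ _ fun x => by
    simp only [g', ContinuousMap.coe_mk]
    have hx := hle g x
    by_cases hxc : c - 2 * ε ≤ J (g.1 x)
    · have := ht1 _ ⟨x, rfl⟩ ht.le ⟨hgU x, abs_le.2 ⟨by linarith, by linarith⟩⟩
      linarith
    · have := ht2 _ ⟨x, rfl⟩
      linarith
  have := hg2 g'
  nlinarith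

/-- The Palais–Smale condition. -/
def PalaisSmale (J : X → ℝ) : Prop :=
  ∀ u : ℕ → X, (∃ C : ℝ, ∀ n, |J (u n)| ≤ C) →
    Tendsto (fun n => fderiv ℝ J (u n)) atTop (nhds 0) →
    ∃ φ : ℕ → ℕ, StrictMono φ ∧ ∃ x : X, Tendsto (u ∘ φ) atTop (nhds x)

/-- The critical points of `J` at level `c`. -/
def critSet (J : X → ℝ) (c : ℝ) : Set X := {u | fderiv ℝ J u = 0 ∧ J u = c}

theorem isCompact_critSet (hJ : ContDiff ℝ 1 J) (hPS : PalaisSmale J) (c : ℝ) :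
    IsCompact (critSet J c) := by
  have hcl : IsClosed (critSet J c) :=
    (isClosed_eq (hJ.continuous_fderiv one_ne_zero) continuous_const).inter
      (isClosed_eq hJ.continuous continuous_const)
  refine IsSeqCompact.isCompact fun u hu => ?_
  obtain ⟨φ, hφ, x, hx⟩ := hPS u ⟨|c|, fun n => by rw [(hu n).2]⟩
    (tendsto_const_nhds.congr fun n => (hu n).1.symm)
  exact ⟨x, hcl.mem_of_tendsto hx (Eventually.of_forall fun n => hu _), φ, hφ, hx⟩

theorem exists_pos_le_norm_fderiv (hJ : ContDiff ℝ 1 J) (hPS : PalaisSmale J) {c : ℝ}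
    {U : Set X} (hU : IsOpen U) (hKU : critSet J c ⊆ U) :
    ∃ σ > 0, ∀ u, u ∉ U → |J u - c| ≤ σ → σ ≤ ‖fderiv ℝ J u‖ := by
  by_contra! hcon
  have h0 := tendsto_one_div_add_atTop_nhds_zero_nat (𝕜 := ℝ)
  choose u hu using fun n : ℕ => hcon _ (Nat.one_div_pos_of_nat (α := ℝ) (n := n))
  have hJu : Tendsto (fun n => J (u n)) atTop (nhds c) := by
    rw [tendsto_iff_dist_tendsto_zero]
    exact squeeze_zero (fun _ => dist_nonneg) (fun n => (hu n).2.1) h0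
  obtain ⟨φ, hφ, x, hx⟩ := hPS u (by
      obtain ⟨C, hC⟩ := (Metric.isBounded_range_of_tendsto _ hJu).exists_norm_le
      exact ⟨C, fun n => hC _ ⟨n, rfl⟩⟩)
    (squeeze_zero_norm (fun n => (hu n).2.2.le) h0)
  have hxc : J x = c := tendsto_nhds_unique ((hJ.continuous.tendsto x).comp hx)
    (hJu.comp hφ.tendsto_atTop)
  have hx0 : fderiv ℝ J x = 0 :=
    tendsto_nhds_unique (((hJ.continuous_fderiv one_ne_zero).tendsto x).comp hx)
      ((squeeze_zero_norm (fun n => (hu n).2.2.le) h0).comp hφ.tendsto_atTop)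
  have hxU : x ∉ U := hU.isClosed_compl.mem_of_tendsto hx (Eventually.of_forall fun n => (hu _).1)
  exact hxU (hKU ⟨hx0, hxc⟩)

/-- Every compact symmetric subset of the sublevel set `{J ≤ c}` has genus at most `m`. -/
def SublevelGenusLE (J : X → ℝ) (c : ℝ) (m : ℕ) : Prop :=
  ∀ A : Set X, IsCompact A → (∀ x ∈ A, -x ∈ A) → (∀ x ∈ A, J x ≤ c) → GenusLE m A

theorem SublevelGenusLE.mono {Y : Type*} [NormedAddCommGroup Y] {J : Y → ℝ} {c c' : ℝ} {m : ℕ}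
    (h : SublevelGenusLE J c' m) (hc : c ≤ c') :
    SublevelGenusLE J c m := fun A hA hAs hAc => h A hA hAs fun x hx => (hAc x hx).trans hc

theorem exists_sublevelGenusLE_add [CompleteSpace X] (hJ : ContDiff ℝ 1 J)
    (hPS : PalaisSmale J) (heven : ∀ u, J (-u) = J u) (hbdd : BddBelow (Set.range J)) {c : ℝ}
    {p : ℕ} (hp : GenusLE p (critSet J c)) :
    ∃ ε > 0, ∀ m, SublevelGenusLE J (c - ε) m → SublevelGenusLE J (c + ε) (m + p) := by
  obtain ⟨f, hf, fo, fn⟩ := hp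
  have hO : IsOpen {u | ∃ i, f i u ≠ 0} := by
    simp only [Set.ofPred_exists]
    exact isOpen_iUnion fun i => isOpen_ne_fun (hf i) continuous_const
  obtain ⟨δ, hδ, hδO⟩ := (isCompact_critSet hJ hPS c).exists_cthickening_subset_open hO fn
  have hKs : ∀ x ∈ critSet J c, -x ∈ critSet J c := fun x hx =>
    ⟨by rw [fderiv_neg_of_even (hJ.differentiable one_ne_zero) heven, hx.1, neg_zero],
      by rw [heven, hx.2]⟩
  have hTs : ∀ s, ∀ x ∈ Metric.thickening s (critSet J c),
      -x ∈ Metric.thickening s (critSet J c) := by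
    intro s x hx
    obtain ⟨k, hk, hxk⟩ := Metric.mem_thickening_iff.1 hx
    exact Metric.mem_thickening_iff.2 ⟨-k, hKs k hk, by rwa [dist_neg_neg]⟩
  obtain ⟨σ, hσ, hσU⟩ := exists_pos_le_norm_fderiv hJ hPS
    (Metric.isOpen_thickening (δ := δ / 2) (E := critSet J c))
    (Metric.self_subset_thickening (half_pos hδ) _)
  have hε : 0 < min (σ / 2) (σ * (δ / 2) / 16) := by positivity
  refine ⟨_, hε, fun m hm A hA hAs hAc => ?_⟩
  have h1 := min_le_left (σ / 2) (σ * (δ / 2) / 16)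
  have h2 := min_le_right (σ / 2) (σ * (δ / 2) / 16)
  generalize min (σ / 2) (σ * (δ / 2) / 16) = ε at *
  have hBs : ∀ x ∈ A \ Metric.thickening δ (critSet J c),
      -x ∈ A \ Metric.thickening δ (critSet J c) :=
    fun x hx => ⟨hAs x hx.1, fun h => hx.2 (by simpa using hTs _ _ h)⟩
  have hB : IsCompact (A \ Metric.thickening δ (critSet J c)) := hA.diff Metric.isOpen_thickening
  obtain ⟨g, hg, hgc⟩ := exists_odd_deformation hJ heven hbdd hB hBs
    (Metric.isOpen_thickening (δ := δ / 2) (E := critSet J c)) (hTs _) hε hσ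
    (fun x hx => hAc x hx.1) (r := δ / 2) (fun x hx u hux hu => hx.2 (by
      obtain ⟨k, hk, huk⟩ := Metric.mem_thickening_iff.1 hu
      refine Metric.mem_thickening_iff.2 ⟨k, hk, ?_⟩
      have := dist_triangle_left x k u
      linarith)) (fun u hu huc => hσU u hu (huc.trans (by linarith))) (by linarith)
  have hcomp : CompactSpace ↥(A \ Metric.thickening δ (critSet J c)) :=
    isCompact_iff_compactSpace.1 hB
  have hrange : GenusLE m (Set.range g) := hm _ (isCompact_range g.continuous)
    (by rintro _ ⟨x, rfl⟩; exact ⟨_, hg x⟩) (by rintro _ ⟨x, rfl⟩; exact hgc x)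
  have hT : GenusLE p (Metric.thickening δ (critSet J c)) :=
    ⟨f, hf, fo, fun x hx => hδO (Metric.thickening_subset_cthickening _ _ hx)⟩
  exact ((hrange.of_odd_map hB.isClosed hBs g hg fun x => ⟨x, rfl⟩).union hT).mono (by simp)

theorem real_continuation {Q : ℝ → Prop} (hQ : ∀ {s t}, s ≤ t → Q t → Q s) {a b : ℝ} (hab : a ≤ b)
    (ha : Q a) (h : ∀ c ∈ Set.Icc a b, ∃ ε > 0, Q (c - ε) → Q (c + ε)) : Q b := by
  have hbd : BddAbove {t | t ∈ Set.Icc a b ∧ Q t} := ⟨b, fun t ht => ht.1.2⟩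
  have haS : a ∈ {t | t ∈ Set.Icc a b ∧ Q t} := ⟨⟨le_rfl, hab⟩, ha⟩
  have hac := le_csSup hbd haS
  obtain ⟨ε, hε, hc⟩ := h _ ⟨hac, csSup_le ⟨a, haS⟩ fun t ht => ht.1.2⟩
  obtain ⟨t, ht, hlt⟩ := exists_lt_of_lt_csSup ⟨a, haS⟩ (sub_lt_self _ hε)
  have hQc := hc (hQ hlt.le ht.2)
  by_contra hb
  have hlt' : sSup {t | t ∈ Set.Icc a b ∧ Q t} + ε < b := lt_of_not_ge fun hge => hb (hQ hge hQc)
  have := le_csSup hbd (show _ ∈ {t | t ∈ Set.Icc a b ∧ Q t} from ⟨⟨by linarith, hlt'.le⟩, hQc⟩)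
  linarith

theorem exists_critical_value_near_zero [CompleteSpace X] (hJ : ContDiff ℝ 1 J)
    (hPS : PalaisSmale J) (heven : ∀ u, J (-u) = J u) (hbdd : BddBelow (Set.range J))
    (hJ0 : J 0 = 0)
    (hgeom : ∀ k : ℕ, 1 ≤ k → ∃ ρ : ℝ, 0 < ρ ∧ ∃ W : Submodule ℝ X,
      Module.finrank ℝ W = k ∧ sSup (J '' {u : X | u ∈ W ∧ ‖u‖ = ρ}) < 0) {δ : ℝ} (hδ : 0 < δ) :
    ∃ u, fderiv ℝ J u = 0 ∧ -δ < J u ∧ J u < 0 := by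
  by_contra! hcon
  have hstart : ∃ a ≤ -δ / 2, SublevelGenusLE J a 0 := by
    obtain ⟨M, hM⟩ := hbdd
    refine ⟨min (M - 1) (-δ / 2), min_le_right _ _, fun A _ _ hA => ?_⟩
    refine ⟨fun _ _ => 0, fun _ => continuous_const, fun _ _ => by simp, fun x hx => ?_⟩
    have := hM ⟨x, rfl⟩
    have := (hA x hx).trans (min_le_left _ _)
    linarith
  obtain ⟨a, ha, hQa⟩ := hstart
  obtain ⟨m, hm⟩ : ∃ m, SublevelGenusLE J (-δ / 2) m := by
    refine real_continuation (Q := fun c => ∃ m, SublevelGenusLE J c m)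
      (fun hst ⟨m, h⟩ => ⟨m, h.mono hst⟩) ha ⟨0, hQa⟩ fun c hc => ?_
    obtain ⟨p, hp⟩ := exists_genusLE_of_isCompact (isCompact_critSet hJ hPS c)
      (fun h => by linarith [hc.2, h.2.symm.trans hJ0])
    obtain ⟨ε, hε, h⟩ := exists_sublevelGenusLE_add hJ hPS heven hbdd hp
    exact ⟨ε, hε, fun ⟨m, hm⟩ => ⟨_, h m hm⟩⟩
  have hall : ∀ b, -δ / 2 ≤ b → b < 0 → SublevelGenusLE J b m := by
    intro b hb hb0
    refine real_continuation (Q := fun c => SublevelGenusLE J c m)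
      (fun hst h => h.mono hst) hb hm fun c hc => ?_
    have hp : GenusLE 0 (critSet J c) := by
      refine ⟨fun _ _ => 0, fun _ => continuous_const, fun _ _ => by simp, fun x hx => ?_⟩
      have := hcon x hx.1 (by linarith [hx.2, hc.1])
      linarith [hx.2, hc.2]
    obtain ⟨ε, hε, h⟩ := exists_sublevelGenusLE_add hJ hPS heven hbdd hp
    exact ⟨ε, hε, h m⟩
  obtain ⟨ρ, hρ, W, hW, hs⟩ := hgeom (m + 1) (by omega)
  have hfd : FiniteDimensional ℝ W := Module.finite_of_finrank_pos (by omega)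
  have hcomp : IsCompact {u : X | u ∈ W ∧ ‖u‖ = ρ} := by
    have himg := (isCompact_sphere (0 : W) ρ).image continuous_subtype_val
    convert himg using 1
    ext u
    simp [and_comm]
  set s := sSup (J '' {u : X | u ∈ W ∧ ‖u‖ = ρ})
  have hgen : GenusLE m {u : X | u ∈ W ∧ ‖u‖ = ρ} :=
    hall (max (-δ / 2) s) (le_max_left _ _) (max_lt (by linarith) hs) _ hcomp
      (fun x hx => ⟨W.neg_mem hx.1, by rw [norm_neg]; exact hx.2⟩)
      (fun x hx => (le_csSup (hcomp.image hJ.continuous).bddAbove ⟨x, hx, rfl⟩).trans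
        (le_max_right _ _))
  have := le_of_genusLE_sphere hW (by omega) hρ hgen
  omega

end Deformation

theorem clark_heinz_wang
    (X : Type*) [NormedAddCommGroup X] [NormedSpace ℝ X] [CompleteSpace X]
    (J : X → ℝ) (hJ : ContDiff ℝ 1 J)
    (hPS : ∀ u : ℕ → X, (∃ C : ℝ, ∀ n, |J (u n)| ≤ C) →
      Filter.Tendsto (fun n => fderiv ℝ J (u n)) Filter.atTop (nhds 0) →
      ∃ φ : ℕ → ℕ, StrictMono φ ∧ ∃ x : X, Filter.Tendsto (u ∘ φ) Filter.atTop (nhds x))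
    (heven : ∀ u : X, J (-u) = J u)
    (hbdd : BddBelow (Set.range J))
    (hJ0 : J 0 = 0)
    (hgeom : ∀ k : ℕ, 1 ≤ k → ∃ ρ : ℝ, 0 < ρ ∧ ∃ Xk : Submodule ℝ X,
      Module.finrank ℝ Xk = k ∧ sSup (J '' {u : X | u ∈ Xk ∧ ‖u‖ = ρ}) < 0) :
    ∃ u : ℕ → X, (∀ k, fderiv ℝ J (u k) = 0 ∧ J (u k) < 0) ∧
      Filter.Tendsto (fun k => J (u k)) Filter.atTop (nhds 0) := by
  choose u hu using fun n : ℕ => exists_critical_value_near_zero hJ hPS heven hbdd hJ0 hgeom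
    (Nat.one_div_pos_of_nat (α := ℝ) (n := n))
  refine ⟨u, fun k => ⟨(hu k).1, (hu k).2.2⟩, ?_⟩
  have h0 := (tendsto_one_div_add_atTop_nhds_zero_nat (𝕜 := ℝ)).neg
  rw [neg_zero] at h0
  exact tendsto_of_tendsto_of_tendsto_of_le_of_le h0 tendsto_const_nhds
    (fun k => (hu k).2.1.le) (fun k => (hu k).2.2.le)
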